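/- arXiv:1804.03466 — 2 statements merged into one kernel-verified Lean document; each statement's English description precedes it below -/
import Mathlib

section
/- Let 0 < p < ∞, m ≥ 0, and let f : ℝ^n → [0,∞) be Borel measurable, homogeneous of degree m (f(tx) = t^m f(x) for all t ≥ 0, x ∈ ℝ^n), not almost everywhere zero, and such that 0 < ∫_{ℝ^n} e^{−‖x‖_p^p} f(x) dx < ∞. Let X = (X_1,…,X_n) be a random vector with Lebesgue density x ↦ C_{p,f,n} e^{−‖x‖_p^p} f(x) (C_{p,f,n} the normalization constant), and let U be uniformly distributed on [0,1] and independent of X. Then the random vector U^{1/(n+m)} · X/‖X‖_p has a Lebesgue density on ℝ^n of the form x ↦ c f(x) 1{x ∈ B_p^n} for a suitable normalization constant c ∈ (0,∞). -/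
open MeasureTheory ENNReal

set_option autoImplicit false

noncomputable section

/-- The `p`-norm `‖x‖_p = (Σ_i |x_i|^p)^{1/p}` on `ℝ^n`. -/
def pNorm {n : ℕ} (p : ℝ) (x : Fin n → ℝ) : ℝ :=
  (∑ i, |x i| ^ p) ^ (1 / p)

/-- The radial projection `x ↦ x/‖x‖_p`. -/
def pProj {n : ℕ} (p : ℝ) (x : Fin n → ℝ) : Fin n → ℝ :=
  (pNorm p x)⁻¹ • x

/-- Scaling of an integral against a homogeneous density of degree `m`. -/
theorem lintegral_homogeneous_mul_comp_smul {n : ℕ} {m : ℝ} {f : (Fin n → ℝ) → ℝ}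
    (hf_meas : Measurable f) (hf_hom : ∀ t : ℝ, 0 ≤ t → ∀ x, f (t • x) = t ^ m * f x)
    {t : ℝ} (ht : 0 < t) {g : (Fin n → ℝ) → ℝ≥0∞} (hg : Measurable g) :
    ∫⁻ x, ENNReal.ofReal (f x) * g (t • x) =
      ENNReal.ofReal (t ^ (-((n : ℝ) + m))) * ∫⁻ x, ENNReal.ofReal (f x) * g x := by
  have hF (x : Fin n → ℝ) :
      ENNReal.ofReal (f x) = ENNReal.ofReal (t ^ (-m)) * ENNReal.ofReal (f (t • x)) := by
    rw [← ENNReal.ofReal_mul (by positivity), hf_hom t ht.le, ← mul_assoc,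
      ← Real.rpow_add ht, neg_add_cancel, Real.rpow_zero, one_mul]
  have hmeas : Measurable fun y => ENNReal.ofReal (t ^ (-m)) * ENNReal.ofReal (f y) * g y := by
    fun_prop
  calc ∫⁻ x, ENNReal.ofReal (f x) * g (t • x)
      = ∫⁻ x, (fun y => ENNReal.ofReal (t ^ (-m)) * ENNReal.ofReal (f y) * g y) (t • x) := by
        refine lintegral_congr fun x => ?_
        rw [hF x]
    _ = ENNReal.ofReal (|(t ^ n)⁻¹|) *
          ∫⁻ y, ENNReal.ofReal (t ^ (-m)) * ENNReal.ofReal (f y) * g y := by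
        rw [← lintegral_map hmeas (measurable_const_smul t),
          Measure.map_addHaar_smul volume ht.ne', lintegral_smul_measure]
        simp
    _ = _ := by
        simp_rw [mul_assoc]
        rw [lintegral_const_mul _ (by fun_prop), ← mul_assoc,
          ← ENNReal.ofReal_mul (abs_nonneg _), abs_of_pos (by positivity), neg_add,
          Real.rpow_add ht, Real.rpow_neg ht.le (n : ℝ), Real.rpow_natCast]

/-- Linear substitution on the positive half-line. -/
theorem lintegral_Ioi_comp_mul_left {a : ℝ} (ha : 0 < a) (g : ℝ → ℝ≥0∞) :
    ∫⁻ u in Set.Ioi 0, g u = ∫⁻ r in Set.Ioi 0, ENNReal.ofReal a * g (a * r) := by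
  have him : (fun r => a * r) '' Set.Ioi 0 = Set.Ioi 0 := by
    simpa using Set.image_mul_left_Ioi ha 0
  have h := lintegral_image_eq_lintegral_abs_deriv_mul (f' := fun _ => a)
    (measurableSet_Ioi (a := (0 : ℝ)))
    (fun r _ => by simpa using ((hasDerivAt_id r).const_mul a).hasDerivWithinAt)
    (mul_right_injective₀ ha.ne').injOn g
  rwa [him, abs_of_pos ha] at h

/-- The substitution `q = a / r` on the positive half-line. -/
theorem lintegral_Ioi_comp_div {a : ℝ} (ha : 0 < a) (g : ℝ → ℝ≥0∞) :
    ∫⁻ q in Set.Ioi 0, g q =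
      ∫⁻ r in Set.Ioi 0, ENNReal.ofReal r⁻¹ * (ENNReal.ofReal (a / r) * g (a / r)) := by
  have him : (fun r => a / r) '' Set.Ioi 0 = Set.Ioi 0 := by
    ext q
    constructor
    · rintro ⟨r, hr, rfl⟩
      exact div_pos ha hr
    · exact fun hq => ⟨a / q, div_pos ha hq, div_div_cancel₀ ha.ne'⟩
  have hinj : Set.InjOn (fun r => a / r) (Set.Ioi 0) := by
    intro r _ s _ h
    simpa [div_eq_mul_inv, ha.ne'] using h
  have h := lintegral_image_eq_lintegral_abs_deriv_mul (f := fun r => a / r)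
    (f' := fun r => a * -(r ^ 2)⁻¹)
    (measurableSet_Ioi (a := (0 : ℝ)))
    (fun r hr => ((hasDerivAt_inv (ne_of_gt hr)).const_mul a).hasDerivWithinAt) hinj g
  rw [him] at h
  rw [h]
  refine setLIntegral_congr_fun measurableSet_Ioi fun r (hr : 0 < r) => ?_
  have hder : |a * -(r ^ 2)⁻¹| = r⁻¹ * (a / r) := by
    rw [mul_neg, abs_neg, abs_of_pos (by positivity)]
    field_simp
  simp only [hder, ENNReal.ofReal_mul (inv_nonneg.2 hr.le), mul_assoc]

theorem rpow_le_one_iff_of_exponent_pos {x z : ℝ} (hx : 0 ≤ x) (hz : 0 < z) :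
    x ^ z ≤ 1 ↔ x ≤ 1 := by
  simpa using Real.rpow_le_rpow_iff hx zero_le_one hz

theorem pNorm_nonneg {n : ℕ} (p : ℝ) (x : Fin n → ℝ) : 0 ≤ pNorm p x :=
  Real.rpow_nonneg (Finset.sum_nonneg fun _ _ => Real.rpow_nonneg (abs_nonneg _) _) _

theorem pNorm_rpow {n : ℕ} {p : ℝ} (hp : p ≠ 0) (x : Fin n → ℝ) :
    pNorm p x ^ p = ∑ i, |x i| ^ p := by
  rw [pNorm, ← Real.rpow_mul (Finset.sum_nonneg fun _ _ => Real.rpow_nonneg (abs_nonneg _) _),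
    one_div_mul_cancel hp, Real.rpow_one]

theorem pNorm_smul {n : ℕ} {p : ℝ} (hp : p ≠ 0) {t : ℝ} (ht : 0 ≤ t) (x : Fin n → ℝ) :
    pNorm p (t • x) = t * pNorm p x := by
  have hsum : ∑ i, |(t • x) i| ^ p = t ^ p * ∑ i, |x i| ^ p := by
    rw [Finset.mul_sum]
    refine Finset.sum_congr rfl fun i _ => ?_
    rw [Pi.smul_apply, smul_eq_mul, abs_mul, abs_of_nonneg ht, Real.mul_rpow ht (abs_nonneg _)]
  rw [pNorm, hsum, Real.mul_rpow (by positivity)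
    (Finset.sum_nonneg fun _ _ => Real.rpow_nonneg (abs_nonneg _) _), ← Real.rpow_mul ht,
    mul_one_div_cancel hp, Real.rpow_one, pNorm]

theorem pNorm_pos {n : ℕ} {p : ℝ} {x : Fin n → ℝ} (hx : x ≠ 0) : 0 < pNorm p x := by
  obtain ⟨i, hi⟩ := Function.ne_iff.1 hx
  exact Real.rpow_pos_of_pos (Finset.sum_pos' (fun _ _ => Real.rpow_nonneg (abs_nonneg _) _)
    ⟨i, Finset.mem_univ i, Real.rpow_pos_of_pos (abs_pos.2 hi) _⟩) _

theorem measurable_pNorm {n : ℕ} (p : ℝ) :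
    Measurable (pNorm p : (Fin n → ℝ) → ℝ) := by
  unfold pNorm
  fun_prop

theorem measurable_pProj {n : ℕ} (p : ℝ) :
    Measurable (pProj p : (Fin n → ℝ) → (Fin n → ℝ)) :=
  (measurable_pNorm p).inv.smul measurable_id

/-- The mean of `φ` along the radius from the origin to `x / ‖x‖_p`, expressed through the
multiples of `x`. -/
theorem lintegral_Icc_smul_pProj {n : ℕ} {p d : ℝ} (hp : p ≠ 0) (hd : 0 < d)
    {x : Fin n → ℝ} (hx : x ≠ 0) (φ : (Fin n → ℝ) → ℝ≥0∞) :
    ∫⁻ u in Set.Icc (0 : ℝ) 1, φ (u ^ (1 / d) • pProj p x) =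
      ∫⁻ r in Set.Ioi (0 : ℝ), ENNReal.ofReal (pNorm p x ^ d) *
        {y | pNorm p y ≤ 1}.indicator φ (r ^ (1 / d) • x) := by
  have hN : 0 < pNorm p x := pNorm_pos hx
  have hQ : (pNorm p x ^ d) ^ (1 / d) = pNorm p x := by
    rw [← Real.rpow_mul hN.le, mul_one_div_cancel hd.ne', Real.rpow_one]
  have hIoc : Set.Ioc (0 : ℝ) 1 = Set.Iic 1 ∩ Set.Ioi 0 := by
    rw [Set.inter_comm, Set.Ioi_inter_Iic]
  rw [setLIntegral_congr Ioc_ae_eq_Icc.symm, hIoc, ← setLIntegral_indicator measurableSet_Iic,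
    lintegral_Ioi_comp_mul_left (Real.rpow_pos_of_pos hN d)]
  refine setLIntegral_congr_fun measurableSet_Ioi fun r (hr : 0 < r) => ?_
  have hroot : (pNorm p x ^ d * r) ^ (1 / d) = pNorm p x * r ^ (1 / d) := by
    rw [Real.mul_rpow (by positivity) hr.le, hQ]
  have hpoint : (pNorm p x ^ d * r) ^ (1 / d) • pProj p x = r ^ (1 / d) • x := by
    rw [hroot, pProj, smul_smul]
    congr 1
    field_simp
  have hmem : pNorm p x ^ d * r ∈ Set.Iic 1 ↔ r ^ (1 / d) • x ∈ {y | pNorm p y ≤ 1} := by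
    rw [Set.mem_Iic, Set.mem_ofPred_eq, pNorm_smul hp (by positivity), mul_comm (r ^ (1 / d)),
      ← hroot]
    exact (rpow_le_one_iff_of_exponent_pos (by positivity) (by positivity)).symm
  simp only [Set.indicator_apply, hmem, hpoint]

/-- Integrating out the radius: averaging `φ` over the rescaled radial projection, against a
density which is the product of a radial weight and a homogeneous function `f`, amounts to
integrating `φ f` over the unit ball, up to a constant. -/
theorem lintegral_radial_mul_homogeneous {n : ℕ} (hn : 0 < n) {p m : ℝ} (hp : p ≠ 0)
    (hm : 0 ≤ m) {f : (Fin n → ℝ) → ℝ} (hf_meas : Measurable f)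
    (hf_hom : ∀ t : ℝ, 0 ≤ t → ∀ x, f (t • x) = t ^ m * f x)
    {w : ℝ → ℝ≥0∞} (hw : Measurable w) {φ : (Fin n → ℝ) → ℝ≥0∞} (hφ : Measurable φ) :
    ∫⁻ x, w (pNorm p x ^ ((n : ℝ) + m)) * ENNReal.ofReal (f x) *
        ∫⁻ u in Set.Icc (0 : ℝ) 1, φ (u ^ (1 / ((n : ℝ) + m)) • pProj p x) =
      (∫⁻ q in Set.Ioi 0, w q) *
        ∫⁻ x, ENNReal.ofReal (f x) * {y | pNorm p y ≤ 1}.indicator φ x := by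
  have hd : 0 < (n : ℝ) + m := by positivity
  set d := (n : ℝ) + m with hd_def
  have hball : MeasurableSet {y : Fin n → ℝ | pNorm p y ≤ 1} :=
    measurableSet_le (measurable_pNorm p) measurable_const
  set Φ := {y : Fin n → ℝ | pNorm p y ≤ 1}.indicator φ with hΦ_def
  have hΦ : Measurable Φ := hφ.indicator hball
  have hN := measurable_pNorm (n := n) p
  have : Nonempty (Fin n) := ⟨⟨0, hn⟩⟩
  have hne : ∀ᵐ x : Fin n → ℝ, x ≠ 0 := Measure.ae_ne volume 0
  let H : ℝ → (Fin n → ℝ) → ℝ≥0∞ := fun r y =>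
    ENNReal.ofReal (pNorm p y ^ d / r) * w (pNorm p y ^ d / r) * Φ y
  have hH : Measurable (Function.uncurry H) := by
    have hdiv : Measurable fun z : ℝ × (Fin n → ℝ) => pNorm p z.2 ^ d / z.1 := by fun_prop
    exact (hdiv.ennreal_ofReal.mul (hw.comp hdiv)).mul (hΦ.comp measurable_snd)
  have hHr (r : ℝ) : Measurable (H r) := hH.of_uncurry_left
  calc ∫⁻ x, w (pNorm p x ^ d) * ENNReal.ofReal (f x) *
        ∫⁻ u in Set.Icc (0 : ℝ) 1, φ (u ^ (1 / d) • pProj p x)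
      = ∫⁻ x, ∫⁻ r in Set.Ioi (0 : ℝ),
          ENNReal.ofReal (f x) * H r (r ^ (1 / d) • x) := by
        refine lintegral_congr_ae (hne.mono fun x hx => ?_)
        simp only
        rw [lintegral_Icc_smul_pProj hp hd hx, ← lintegral_const_mul _ (by fun_prop)]
        refine setLIntegral_congr_fun measurableSet_Ioi fun r (hr : 0 < r) => ?_
        have hQ : pNorm p (r ^ (1 / d) • x) ^ d / r = pNorm p x ^ d := by
          rw [pNorm_smul hp (by positivity), Real.mul_rpow (by positivity) (pNorm_nonneg p x),
            ← Real.rpow_mul hr.le, one_div_mul_cancel hd.ne', Real.rpow_one,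
            mul_div_cancel_left₀ _ hr.ne']
        simp only [H, hQ]
        ring
    _ = ∫⁻ r in Set.Ioi 0, ∫⁻ x, ENNReal.ofReal (f x) * H r (r ^ (1 / d) • x) := by
        have hsmul : Measurable fun z : (Fin n → ℝ) × ℝ => z.2 ^ (1 / d) • z.1 :=
          (measurable_snd.pow_const _).smul measurable_fst
        have hG : Measurable (Function.uncurry fun (x : Fin n → ℝ) (r : ℝ) =>
            ENNReal.ofReal (f x) * H r (r ^ (1 / d) • x)) := by
          have hHs := hH.comp (measurable_snd.prodMk hsmul)
          exact Measurable.mul (hf_meas.comp measurable_fst).ennreal_ofReal hHs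
        exact lintegral_lintegral_swap hG.aemeasurable
    _ = ∫⁻ r in Set.Ioi 0, ∫⁻ x, ENNReal.ofReal r⁻¹ * (ENNReal.ofReal (f x) * H r x) := by
        refine setLIntegral_congr_fun measurableSet_Ioi fun r (hr : 0 < r) => ?_
        have hr' : (r ^ (1 / d)) ^ (-d) = r⁻¹ := by
          rw [← Real.rpow_mul hr.le, one_div, mul_neg, inv_mul_cancel₀ hd.ne', Real.rpow_neg_one]
        rw [lintegral_homogeneous_mul_comp_smul hf_meas hf_hom (by positivity) (hHr r), ← hd_def,
          hr']
        exact (lintegral_const_mul _ (hf_meas.ennreal_ofReal.mul (hHr r))).symm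
    _ = ∫⁻ x, ∫⁻ r in Set.Ioi 0, ENNReal.ofReal r⁻¹ * (ENNReal.ofReal (f x) * H r x) := by
        refine lintegral_lintegral_swap (Measurable.aemeasurable ?_)
        exact measurable_fst.inv.ennreal_ofReal.mul
          ((hf_meas.comp measurable_snd).ennreal_ofReal.mul hH)
    _ = ∫⁻ x, (∫⁻ q in Set.Ioi 0, w q) * (ENNReal.ofReal (f x) * Φ x) := by
        refine lintegral_congr_ae (hne.mono fun x hx => ?_)
        simp only
        rw [lintegral_Ioi_comp_div (Real.rpow_pos_of_pos (pNorm_pos (p := p) hx) d) w,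
          ← lintegral_mul_const _ (by fun_prop)]
        refine lintegral_congr fun r => ?_
        simp only [H]
        ring
    _ = (∫⁻ q in Set.Ioi 0, w q) * ∫⁻ x, ENNReal.ofReal (f x) * Φ x :=
        lintegral_const_mul _ (hf_meas.ennreal_ofReal.mul hΦ)

theorem stmt12 (n : ℕ) (hn : 0 < n) (p : ℝ) (hp : 0 < p) (m : ℝ) (hm : 0 ≤ m)
    (f : (Fin n → ℝ) → ℝ) (hf_meas : Measurable f) (hf_nonneg : ∀ x, 0 ≤ f x)
    (hf_hom : ∀ t : ℝ, 0 ≤ t → ∀ x, f (t • x) = t ^ m * f x)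
    (hf_int : Integrable (fun x : Fin n → ℝ => Real.exp (-∑ i, |x i| ^ p) * f x))
    (hf_pos : 0 < ∫ x : Fin n → ℝ, Real.exp (-∑ i, |x i| ^ p) * f x)
    -- `μX` is the law of `X`, with density `x ↦ C e^{-‖x‖_p^p} f(x)`,
    -- `C` being the normalization constant
    (C : ℝ) (μX : Measure (Fin n → ℝ))
    (hμX : μX = volume.withDensity fun x : Fin n → ℝ =>
      ENNReal.ofReal (C * (Real.exp (-∑ i, |x i| ^ p) * f x)))
    (hprob : IsProbabilityMeasure μX) :
    -- the law of `U^{1/(n+m)} · X/‖X‖_p` (with `U` uniform on `[0,1]` independent of `X`)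
    -- has Lebesgue density `x ↦ c f(x) 1_{B_p^n}(x)`
    ∃ c : ℝ, 0 < c ∧
      Measure.map (fun w : ℝ × (Fin n → ℝ) => (w.1 ^ (1 / ((n : ℝ) + m))) • pProj p w.2)
          ((volume.restrict (Set.Icc (0 : ℝ) 1)).prod μX) =
        volume.withDensity
          ({x : Fin n → ℝ | ∑ i, |x i| ^ p ≤ 1}.indicator
            fun x => ENNReal.ofReal (c * f x)) := by
  have hd : 0 < (n : ℝ) + m := by positivity
  set d := (n : ℝ) + m with hd_def
  let w : ℝ → ℝ≥0∞ := fun q => ENNReal.ofReal (C * Real.exp (-q ^ (p / d)))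
  have hw : Measurable w := by
    unfold w
    fun_prop
  have hwQ (x : Fin n → ℝ) :
      w (pNorm p x ^ d) = ENNReal.ofReal (C * Real.exp (-∑ i, |x i| ^ p)) := by
    simp only [w]
    rw [← Real.rpow_mul (pNorm_nonneg p x), mul_div_cancel₀ _ hd.ne', pNorm_rpow hp.ne']
  have hball : {x : Fin n → ℝ | ∑ i, |x i| ^ p ≤ 1} = {x | pNorm p x ≤ 1} := by
    ext x
    rw [Set.mem_ofPred_eq, Set.mem_ofPred_eq, ← pNorm_rpow hp.ne']
    exact rpow_le_one_iff_of_exponent_pos (pNorm_nonneg p x) hp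
  have hball_meas : MeasurableSet {x : Fin n → ℝ | pNorm p x ≤ 1} :=
    measurableSet_le (measurable_pNorm p) measurable_const
  have hdens (x : Fin n → ℝ) : ENNReal.ofReal (C * (Real.exp (-∑ i, |x i| ^ p) * f x)) =
      w (pNorm p x ^ d) * ENNReal.ofReal (f x) := by
    rw [hwQ, ← ENNReal.ofReal_mul' (hf_nonneg x), mul_assoc]
  have hT : Measurable fun z : ℝ × (Fin n → ℝ) => z.1 ^ (1 / d) • pProj p z.2 :=
    (measurable_fst.pow_const _).smul ((measurable_pProj p).comp measurable_snd)
  have hlaw {φ : (Fin n → ℝ) → ℝ≥0∞} (hφ : Measurable φ) :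
      ∫⁻ y, φ y ∂Measure.map (fun z : ℝ × (Fin n → ℝ) => z.1 ^ (1 / d) • pProj p z.2)
          ((volume.restrict (Set.Icc (0 : ℝ) 1)).prod μX) =
        (∫⁻ q in Set.Ioi 0, w q) *
          ∫⁻ x, ENNReal.ofReal (f x) * {y | pNorm p y ≤ 1}.indicator φ x := by
    have hφT : Measurable fun z : ℝ × (Fin n → ℝ) => φ (z.1 ^ (1 / d) • pProj p z.2) :=
      hφ.comp hT
    rw [lintegral_map hφ hT, lintegral_prod_symm' _ hφT, hμX,
      lintegral_withDensity_eq_lintegral_mul _ (by fun_prop) hφT.lintegral_prod_left',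
      ← lintegral_radial_mul_homogeneous hn hp.ne' hm hf_meas hf_hom hw hφ]
    refine lintegral_congr fun x => ?_
    rw [Pi.mul_apply, hdens]
  have hmass := hlaw (φ := fun _ => 1) measurable_const
  have : IsProbabilityMeasure ((volume : Measure ℝ).restrict (Set.Icc (0 : ℝ) 1)) :=
    ⟨by simp⟩
  have := Measure.isProbabilityMeasure_map (μ := (volume.restrict (Set.Icc (0 : ℝ) 1)).prod μX)
    hT.aemeasurable
  rw [lintegral_one, measure_univ] at hmass
  set K := ∫⁻ q in Set.Ioi 0, w q
  have hK0 : K ≠ 0 := by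
    intro h
    simp [h] at hmass
  have hKtop : K ≠ ∞ := by
    intro h
    rw [h, ENNReal.top_mul'] at hmass
    split_ifs at hmass <;> simp at hmass
  refine ⟨K.toReal, ENNReal.toReal_pos hK0 hKtop, Measure.ext_of_lintegral _ fun φ hφ => ?_⟩
  rw [hball, hlaw hφ, lintegral_withDensity_eq_lintegral_mul _
    (Measurable.indicator (by fun_prop) hball_meas) hφ, ← lintegral_const_mul _
    (by fun_prop (disch := exact hball_meas))]
  refine lintegral_congr fun x => ?_
  by_cases hx : x ∈ {y | pNorm p y ≤ 1}
  · rw [Pi.mul_apply, Set.indicator_of_mem hx, Set.indicator_of_mem hx,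
      ENNReal.ofReal_mul ENNReal.toReal_nonneg, ENNReal.ofReal_toReal hKtop, mul_assoc]
  · rw [Pi.mul_apply, Set.indicator_of_notMem hx, Set.indicator_of_notMem hx, mul_zero, mul_zero,
      zero_mul]

end
end

section
/- For all p > 0 and q > 0, the q-th absolute moment of the Ullman distribution with parameter p satisfies ∫_{−1}^1 |x|^q h_p(x) dx = (p/(p+q)) · Γ((q+1)/2) / (√π Γ((q+2)/2)). In particular, for q = p one gets ∫_{−1}^1 |x|^p h_p(x) dx = (1/2) · Γ((p+1)/2) / (√π Γ((p+2)/2)). -/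
open MeasureTheory

set_option autoImplicit false

noncomputable section

/-- The Ullman density `h_p`. -/
def ullmanDensity (p x : ℝ) : ℝ :=
  if |x| ≤ 1 then (p / Real.pi) * ∫ t in Set.Ioo |x| 1, t ^ (p - 1) / Real.sqrt (t ^ 2 - x ^ 2)
  else 0

/-- Euler's beta integral over the reals. -/
theorem integral_rpow_mul_one_sub_rpow {a b : ℝ} (ha : 0 < a) (hb : 0 < b) :
    ∫ s in (0 : ℝ)..1, s ^ (a - 1) * (1 - s) ^ (b - 1) =
      Real.Gamma a * Real.Gamma b / Real.Gamma (a + b) := by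
  have h := ProbabilityTheory.beta_eq_betaIntegralReal a b ha hb
  rw [ProbabilityTheory.beta] at h
  have h2 : Complex.betaIntegral a b =
      ((∫ s in (0 : ℝ)..1, s ^ (a - 1) * (1 - s) ^ (b - 1) : ℝ) : ℂ) := by
    rw [Complex.betaIntegral, ← intervalIntegral.integral_ofReal]
    refine intervalIntegral.integral_congr fun x hx => ?_
    rw [Set.uIcc_of_le zero_le_one] at hx
    have h1x : 0 ≤ 1 - x := by linarith [hx.2]
    push_cast [Complex.ofReal_cpow hx.1, Complex.ofReal_cpow h1x]
    rfl
  rw [h, h2, Complex.ofReal_re]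

/-- The integrand vanishes for `y ≥ 1`, so this is an integral over `(0, 1)`. -/
theorem integral_rpow_div_sqrt_one_sub_sq {q : ℝ} (hq : 0 < q) :
    ∫ y in Set.Ioi (0 : ℝ), y ^ q / Real.sqrt (1 - y ^ 2) =
      (1 / 2) * (Real.Gamma ((q + 1) / 2) * Real.sqrt Real.pi / Real.Gamma ((q + 2) / 2)) := by
  have hB := integral_rpow_mul_one_sub_rpow (a := (q + 1) / 2) (b := 1 / 2)
    (by linarith) (by norm_num)
  rw [Real.Gamma_one_half_eq, show (q + 1) / 2 + 1 / 2 = (q + 2) / 2 by ring,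
    intervalIntegral.integral_of_le zero_le_one] at hB
  rw [← hB, ← integral_comp_rpow_Ioi_of_pos (p := 1 / 2) (by norm_num), ← integral_const_mul]
  symm
  rw [setIntegral_eq_of_subset_of_forall_sdiff_eq_zero measurableSet_Ioi
    (Set.Ioc_subset_Ioi_self : Set.Ioc (0 : ℝ) 1 ⊆ Set.Ioi 0)]
  · refine setIntegral_congr_fun measurableSet_Ioc fun s hs => ?_
    have hs0 : 0 < s := hs.1
    have hs1 : 0 ≤ 1 - s := by linarith [hs.2]
    have h1 : (s ^ (1 / 2 : ℝ)) ^ 2 = s := by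
      rw [← Real.sqrt_eq_rpow, Real.sq_sqrt hs0.le]
    have h2 : s ^ ((q + 1) / 2 - 1) = s ^ (1 / 2 - 1 : ℝ) * (s ^ (1 / 2 : ℝ)) ^ q := by
      rw [← Real.rpow_mul hs0.le, ← Real.rpow_add hs0]
      congr 1
      ring
    have h3 : (1 - s) ^ (1 / 2 - 1 : ℝ) = (Real.sqrt (1 - s))⁻¹ := by
      rw [Real.sqrt_eq_rpow, ← Real.rpow_neg hs1]
      norm_num
    simp only [smul_eq_mul]
    rw [h1, h2, h3]
    ring
  · rintro s ⟨hs0, hs1⟩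
    have hs0' : 0 < s := hs0
    have h1 : (s ^ (1 / 2 : ℝ)) ^ 2 = s := by
      rw [← Real.sqrt_eq_rpow, Real.sq_sqrt hs0'.le]
    have hs : 1 - s ≤ 0 := by
      by_contra! h
      exact hs1 ⟨hs0', by linarith⟩
    rw [h1, Real.sqrt_eq_zero_of_nonpos hs]
    simp

theorem integral_rpow_div_sqrt_one_sub_sq_pos {q : ℝ} (hq : 0 < q) :
    0 < ∫ y in Set.Ioi (0 : ℝ), y ^ q / Real.sqrt (1 - y ^ 2) := by
  rw [integral_rpow_div_sqrt_one_sub_sq hq]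
  have h1 : 0 < Real.Gamma ((q + 1) / 2) := Real.Gamma_pos_of_pos (by linarith)
  have h2 : 0 < Real.Gamma ((q + 2) / 2) := Real.Gamma_pos_of_pos (by linarith)
  have h3 := Real.pi_pos
  positivity

theorem integral_rpow_div_sqrt_sq_sub_sq {q t : ℝ} (ht : 0 < t) :
    ∫ x in Set.Ioi (0 : ℝ), x ^ q / Real.sqrt (t ^ 2 - x ^ 2) =
      t ^ q * ∫ y in Set.Ioi (0 : ℝ), y ^ q / Real.sqrt (1 - y ^ 2) := by
  have h := integral_comp_mul_left_Ioi' (fun x => x ^ q / Real.sqrt (t ^ 2 - x ^ 2)) 0 ht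
  rw [mul_zero] at h
  rw [← h, ← integral_const_mul, smul_eq_mul, ← integral_const_mul]
  refine setIntegral_congr_fun measurableSet_Ioi fun y hy => ?_
  have hy0 : 0 < y := hy
  have h1 : Real.sqrt (t ^ 2 - (t * y) ^ 2) = t * Real.sqrt (1 - y ^ 2) := by
    rw [show t ^ 2 - (t * y) ^ 2 = t ^ 2 * (1 - y ^ 2) by ring, Real.sqrt_mul (sq_nonneg t),
      Real.sqrt_sq ht.le]
  rw [h1, Real.mul_rpow ht.le hy0.le, mul_div_mul_comm, ← mul_assoc,
    mul_div_cancel₀ _ ht.ne']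

/-- The kernel whose `t`-integral gives `|x| ^ q * ullmanDensity p x` up to a constant. -/
def ullmanKernel (p q x t : ℝ) : ℝ := x ^ q * (t ^ (p - 1) / Real.sqrt (t ^ 2 - x ^ 2))

theorem integral_ullmanKernel {p q t : ℝ} (ht : 0 < t) :
    ∫ x in Set.Ioi (0 : ℝ), ullmanKernel p q x t =
      t ^ (p + q - 1) * ∫ y in Set.Ioi (0 : ℝ), y ^ q / Real.sqrt (1 - y ^ 2) := by
  rw [show p + q - 1 = (p - 1) + q by ring, Real.rpow_add ht, mul_assoc,
    ← integral_rpow_div_sqrt_sq_sub_sq ht, ← integral_const_mul]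
  congr 1 with x
  rw [ullmanKernel]
  ring

theorem integrable_ullmanKernel {p q : ℝ} (hp : 0 < p) (hq : 0 < q) :
    Integrable (Function.uncurry (ullmanKernel p q))
      ((volume.restrict (Set.Ioi (0 : ℝ))).prod (volume.restrict (Set.Ioo (0 : ℝ) 1))) := by
  have hC := integral_rpow_div_sqrt_one_sub_sq_pos hq
  have hmeas : Measurable (Function.uncurry (ullmanKernel p q)) := by
    unfold ullmanKernel Function.uncurry
    fun_prop
  rw [integrable_prod_iff' hmeas.aestronglyMeasurable]
  constructor
  · filter_upwards [ae_restrict_mem measurableSet_Ioo] with t ht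
    refine Integrable.of_integral_ne_zero ?_
    have ht0 : 0 < t := ht.1
    simp only [Function.uncurry_apply_pair]
    rw [integral_ullmanKernel ht0]
    positivity
  · have hint : IntegrableOn (fun t : ℝ => t ^ (p + q - 1) *
        ∫ y in Set.Ioi (0 : ℝ), y ^ q / Real.sqrt (1 - y ^ 2)) (Set.Ioo 0 1) := by
      have h := intervalIntegral.intervalIntegrable_rpow' (a := 0) (b := 1)
        (show -1 < p + q - 1 by linarith)
      rw [intervalIntegrable_iff_integrableOn_Ioo_of_le zero_le_one] at h
      exact h.mul_const _
    refine hint.congr_fun (fun t ht => ?_) measurableSet_Ioo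
    have ht0 : 0 < t := ht.1
    simp only [Function.uncurry_apply_pair]
    rw [← integral_ullmanKernel ht0]
    refine setIntegral_congr_fun measurableSet_Ioi fun x hx => ?_
    have hx0 : 0 < x := hx
    refine (Real.norm_of_nonneg ?_).symm
    unfold ullmanKernel
    positivity

theorem rpow_mul_ullmanDensity {p q x : ℝ} (hx : 0 < x) :
    x ^ q * ullmanDensity p x =
      (p / Real.pi) * ∫ t in Set.Ioo (0 : ℝ) 1, ullmanKernel p q x t := by
  have h0 : ∫ t in Set.Ioo (0 : ℝ) 1, t ^ (p - 1) / Real.sqrt (t ^ 2 - x ^ 2) =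
      ∫ t in Set.Ioo x 1, t ^ (p - 1) / Real.sqrt (t ^ 2 - x ^ 2) := by
    refine setIntegral_eq_of_subset_of_forall_sdiff_eq_zero measurableSet_Ioo
      (Set.Ioo_subset_Ioo_left hx.le) ?_
    rintro t ⟨ht, htx⟩
    have : t ≤ x := by
      by_contra! h
      exact htx ⟨h, ht.2⟩
    rw [Real.sqrt_eq_zero_of_nonpos (by nlinarith [ht.1]), div_zero]
  simp only [ullmanKernel]
  rw [integral_const_mul, h0, ullmanDensity, abs_of_pos hx]
  split_ifs with h
  · ring
  · rw [Set.Ioo_eq_empty (fun h' => h h'.le)]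
    simp

theorem integral_abs_rpow_mul_ullmanDensity {p q : ℝ} (hp : 0 < p) (hq : 0 < q) :
    (∫ x in Set.Icc (-1 : ℝ) 1, |x| ^ q * ullmanDensity p x) =
      (p / (p + q)) * Real.Gamma ((q + 1) / 2) /
        (Real.sqrt Real.pi * Real.Gamma ((q + 2) / 2)) := by
  have hpq : p + q ≠ 0 := by positivity
  rw [setIntegral_eq_integral_of_forall_compl_eq_zero]
  swap
  · intro x hx
    rw [ullmanDensity, if_neg (fun h => hx (abs_le.mp h)), mul_zero]
  have heven : (fun x : ℝ => |x| ^ q * ullmanDensity p x) =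
      fun x : ℝ => (fun y : ℝ => y ^ q * ullmanDensity p y) |x| := by
    ext x
    simp only [ullmanDensity, abs_abs, sq_abs]
  have hpow : ∫ t in Set.Ioo (0 : ℝ) 1, t ^ (p + q - 1) = 1 / (p + q) := by
    rw [← integral_Ioc_eq_integral_Ioo, ← intervalIntegral.integral_of_le zero_le_one,
      integral_rpow (Or.inl (by linarith)), sub_add_cancel, Real.one_rpow, Real.zero_rpow hpq,
      sub_zero]
  rw [heven, integral_comp_abs (f := fun y => y ^ q * ullmanDensity p y),
    setIntegral_congr_fun measurableSet_Ioi fun x hx => rpow_mul_ullmanDensity hx,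
    integral_const_mul, integral_integral_swap (integrable_ullmanKernel hp hq),
    setIntegral_congr_fun measurableSet_Ioo fun t ht => integral_ullmanKernel ht.1,
    integral_mul_const, hpow, integral_rpow_div_sqrt_one_sub_sq hq]
  have hG : Real.Gamma ((q + 2) / 2) ≠ 0 := (Real.Gamma_pos_of_pos (by linarith)).ne'
  have hpi := Real.pi_pos
  have hs : Real.sqrt Real.pi ≠ 0 := by positivity
  have hsq : Real.sqrt Real.pi ^ 2 = Real.pi := Real.sq_sqrt hpi.le
  field_simp
  rw [hsq]

theorem stmt17 (p q : ℝ) (hp : 0 < p) (hq : 0 < q) :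
    (∫ x in Set.Icc (-1 : ℝ) 1, |x| ^ q * ullmanDensity p x) =
      (p / (p + q)) * Real.Gamma ((q + 1) / 2) /
        (Real.sqrt Real.pi * Real.Gamma ((q + 2) / 2)) ∧
    (∫ x in Set.Icc (-1 : ℝ) 1, |x| ^ p * ullmanDensity p x) =
      (1 / 2) * Real.Gamma ((p + 1) / 2) /
        (Real.sqrt Real.pi * Real.Gamma ((p + 2) / 2)) := by
  refine ⟨integral_abs_rpow_mul_ullmanDensity hp hq, ?_⟩
  rw [integral_abs_rpow_mul_ullmanDensity hp hp, show p / (p + p) = 1 / 2 by field_simp; norm_num]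

end
end
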